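/- arXiv:1405.0759 — 3 statements merged into one kernel-verified Lean document; each statement's English description precedes it below -/
import Mathlib

section
/- Let L = ℤ + ℤi ⊆ ℂ and T = ℂ/L. The maps σ₀(z) = iz, σ₂(z) = iz + (3+i)/4 and σ₆(z) = iz + 1/2 induce well-defined bijections σ̄₀, σ̄₂, σ̄₆ of T. Let 𝒢 be the subgroup of the permutation group of T generated by σ̄₀, σ̄₂, σ̄₆. Then: (1) 𝒢 has order 32; (2) the elements of 𝒢 that are induced by translations z ↦ z + c form a normal subgroup N of 𝒢 of order 8 isomorphic to ℤ/2 × ℤ/4, generated by the translations by 1/2 and by (3+i)/4; (3) the quotient 𝒢/N is cyclic of order 4, generated by the image of σ̄₀. -/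
open Complex

/-- The period lattice `L = ℤ + ℤi` as an additive subgroup of `ℂ`. -/
noncomputable def latticeL : AddSubgroup ℂ where
  carrier := {z : ℂ | ∃ m n : ℤ, z = (m : ℂ) + (n : ℂ) * I}
  zero_mem' := ⟨0, 0, by simp⟩
  add_mem' := by
    rintro a b ⟨m, n, rfl⟩ ⟨p, q, rfl⟩
    exact ⟨m + p, n + q, by push_cast; ring⟩
  neg_mem' := by
    rintro a ⟨m, n, rfl⟩
    exact ⟨-m, -n, by push_cast; ring⟩

/-- The complex torus `T = ℂ/L`, `L = ℤ + ℤi`. -/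
abbrev torusT : Type := ℂ ⧸ latticeL

/-- The quotient map `ℂ → ℂ/L`. -/
noncomputable def mkT : ℂ → torusT := QuotientAddGroup.mk

/-- The homomorphism `ℤ/n → G` sending `1` to an element `g` with `g ^ n = 1`. -/
def zmodPowHom {G : Type*} [Group G] {n : ℕ} [NeZero n] (g : G) (hg : g ^ n = 1) :
    Multiplicative (ZMod n) →* G where
  toFun k := g ^ (k.toAdd).val
  map_one' := by simp
  map_mul' a b := by
    rw [toAdd_mul, ZMod.val_add, ← pow_add, ← pow_eq_pow_mod _ hg]

theorem intCast_add_intCast_mul_I_inj {a b c d : ℤ}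
    (h : (a : ℂ) + (b : ℂ) * I = (c : ℂ) + (d : ℂ) * I) : a = c ∧ b = d := by
  simpa [Complex.ext_iff] using h

theorem mkT_add (z w : ℂ) : mkT (z + w) = mkT z + mkT w := rfl

theorem mkT_eq_zero_iff (z : ℂ) : mkT z = 0 ↔ ∃ m n : ℤ, z = (m : ℂ) + (n : ℂ) * I :=
  QuotientAddGroup.eq_zero_iff z

theorem mkT_eq_mkT_iff (z w : ℂ) :
    mkT z = mkT w ↔ ∃ m n : ℤ, z - w = (m : ℂ) + (n : ℂ) * I := by
  rw [← mkT_eq_zero_iff, ← sub_eq_zero]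
  rfl

theorem mkT_surjective : Function.Surjective mkT := QuotientAddGroup.mk_surjective

theorem mkT_gaussian_div_four_eq_zero_iff (p q : ℤ) :
    mkT (((p : ℂ) + q * I) / 4) = 0 ↔ (4 ∣ p) ∧ 4 ∣ q := by
  rw [mkT_eq_zero_iff]
  constructor
  · rintro ⟨m, n, h⟩
    have h' : (p : ℂ) + q * I = ((4 * m : ℤ) : ℂ) + ((4 * n : ℤ) : ℂ) * I := by
      push_cast
      linear_combination 4 * h
    obtain ⟨hp, hq⟩ := intCast_add_intCast_mul_I_inj h'
    exact ⟨⟨m, hp⟩, ⟨n, hq⟩⟩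
  · rintro ⟨⟨m, rfl⟩, ⟨n, rfl⟩⟩
    exact ⟨m, n, by push_cast; ring⟩

/-- Multiplication by `i` on the torus. -/
noncomputable def mulI : torusT →+ torusT :=
  QuotientAddGroup.map latticeL latticeL (AddMonoidHom.mulLeft I) (by
    rintro _ ⟨m, n, rfl⟩
    refine ⟨-n, m, ?_⟩
    simp only [AddMonoidHom.coe_mulLeft]
    push_cast
    linear_combination (n : ℂ) * I_mul_I)

theorem mulI_mkT (z : ℂ) : mulI (mkT z) = mkT (I * z) := rfl

theorem mulI_mulI (x : torusT) : mulI (mulI x) = -x := by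
  obtain ⟨z, rfl⟩ := mkT_surjective x
  rw [mulI_mkT, mulI_mkT, ← mul_assoc, I_mul_I, neg_one_mul]
  rfl

/-- Multiplication by `i` as a permutation of the torus. -/
noncomputable def rotI : Equiv.Perm torusT where
  toFun := mulI
  invFun x := -mulI x
  left_inv x := by simp only [mulI_mulI, neg_neg]
  right_inv x := by simp only [map_neg, mulI_mulI, neg_neg]

theorem rotI_mkT (z : ℂ) : rotI (mkT z) = mkT (I * z) := rfl

theorem rotI_add (x y : torusT) : rotI (x + y) = rotI x + rotI y := map_add mulI x y

theorem rotI_pow_mkT (k : ℕ) (z : ℂ) : (rotI ^ k) (mkT z) = mkT (I ^ k * z) := by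
  induction k with
  | zero => simp
  | succ k ih => rw [pow_succ', Equiv.Perm.mul_apply, ih, rotI_mkT, pow_succ', mul_assoc]

theorem rotI_pow_four : rotI ^ 4 = 1 := by
  ext x
  obtain ⟨z, rfl⟩ := mkT_surjective x
  rw [rotI_pow_mkT, I_pow_four, one_mul, Equiv.Perm.one_apply]

/-- The embedding `ℤ/2 × ℤ/4 → ℂ/L` sending the generators to `1/2` and `(3+i)/4`. -/
noncomputable def torsionHom : ZMod 2 × ZMod 4 →+ torusT :=
  AddMonoidHom.coprod
    (ZMod.lift 2 ⟨zmultiplesHom torusT (mkT (1 / 2)), by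
      refine (mkT_eq_zero_iff ((2 : ℤ) • (1 / 2 : ℂ))).2 ⟨1, 0, ?_⟩
      norm_num⟩)
    (ZMod.lift 4 ⟨zmultiplesHom torusT (mkT ((3 + I) / 4)), by
      refine (mkT_eq_zero_iff ((4 : ℤ) • ((3 + I) / 4 : ℂ))).2 ⟨3, 1, ?_⟩
      push_cast [zsmul_eq_mul]
      ring⟩)

theorem torsionHom_intCast (m n : ℤ) :
    torsionHom ((m : ZMod 2), (n : ZMod 4)) =
      mkT ((((2 * m + 3 * n : ℤ) : ℂ) + n * I) / 4) := by
  have h : torsionHom ((m : ZMod 2), (n : ZMod 4)) =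
      mkT (m • (1 / 2 : ℂ) + n • ((3 + I) / 4 : ℂ)) := by
    simp only [torsionHom, AddMonoidHom.coprod_apply, ZMod.lift_coe]
    rfl
  rw [h]
  congr 1
  push_cast [zsmul_eq_mul]
  ring

theorem torsionHom_injective : Function.Injective torsionHom := by
  rw [injective_iff_map_eq_zero]
  rintro ⟨a, b⟩ h
  obtain ⟨m, rfl⟩ := ZMod.intCast_surjective a
  obtain ⟨n, rfl⟩ := ZMod.intCast_surjective b
  rw [torsionHom_intCast, mkT_gaussian_div_four_eq_zero_iff] at h
  ext
  · exact (ZMod.intCast_zmod_eq_zero_iff_dvd m 2).2 (by omega)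
  · exact (ZMod.intCast_zmod_eq_zero_iff_dvd n 4).2 (by omega)

theorem torsionHom_one_zero : torsionHom (1, 0) = mkT (1 / 2) := by
  have h := torsionHom_intCast 1 0
  norm_num at h
  norm_num [h]

theorem torsionHom_zero_one : torsionHom (0, 1) = mkT ((3 + I) / 4) := by
  have h := torsionHom_intCast 0 1
  norm_num at h
  exact h

/-- Multiplication by `i` on `ℤ/2 × ℤ/4`, seen as the subgroup of `ℂ/L` generated by `1/2`
and `(3+i)/4`. -/
def torsionRot : MulAut (Multiplicative (ZMod 2 × ZMod 4)) where
  toFun u := .ofAdd (u.toAdd.1 + (u.toAdd.2.val : ZMod 2),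
    2 * (u.toAdd.1.val : ZMod 4) + 3 * u.toAdd.2)
  invFun u := .ofAdd (u.toAdd.1 + (u.toAdd.2.val : ZMod 2),
    -(2 * (u.toAdd.1.val : ZMod 4) + 3 * u.toAdd.2))
  left_inv := by unfold Function.LeftInverse; decide
  right_inv := by unfold Function.RightInverse Function.LeftInverse; decide
  map_mul' := by decide

theorem torsionRot_pow_four : torsionRot ^ 4 = 1 := by
  ext1 u
  revert u
  decide

theorem torsionHom_torsionRot (u : Multiplicative (ZMod 2 × ZMod 4)) :
    torsionHom (torsionRot u).toAdd = rotI (torsionHom u.toAdd) := by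
  obtain ⟨a, b⟩ := u
  obtain ⟨m, rfl⟩ := ZMod.intCast_surjective a
  obtain ⟨n, rfl⟩ := ZMod.intCast_surjective b
  have h : (torsionRot (.ofAdd ((m : ZMod 2), (n : ZMod 4)))).toAdd =
      (((m + n : ℤ) : ZMod 2), ((2 * m + 3 * n : ℤ) : ZMod 4)) := by
    refine Prod.ext ?_ ?_
    · change (m : ZMod 2) + ((n : ZMod 4).val : ZMod 2) = _
      rw [← Int.cast_natCast, ZMod.val_intCast, ← Int.cast_add, ZMod.intCast_eq_intCast_iff_dvd_sub]
      omega
    · change 2 * (((m : ZMod 2).val : ℕ) : ZMod 4) + 3 * (n : ZMod 4) = _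
      rw [← Int.cast_natCast, ZMod.val_intCast]
      have h : ((2 * (m % 2) + 3 * n : ℤ) : ZMod 4) = ((2 * m + 3 * n : ℤ) : ZMod 4) := by
        rw [ZMod.intCast_eq_intCast_iff_dvd_sub]
        omega
      simpa using h
  refine (congrArg torsionHom h).trans ?_
  change _ = rotI (torsionHom ((m : ZMod 2), (n : ZMod 4)))
  rw [torsionHom_intCast, torsionHom_intCast, rotI_mkT, mkT_eq_mkT_iff]
  refine ⟨2 * m + 3 * n, 0, ?_⟩
  push_cast
  linear_combination (-(n : ℂ) / 4) * I_mul_I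

/-- Translations by the points of the subgroup generated by `1/2` and `(3+i)/4`. -/
noncomputable def translationHom :
    Multiplicative (ZMod 2 × ZMod 4) →* Equiv.Perm torusT where
  toFun u := Equiv.addRight (torsionHom u.toAdd)
  map_one' := by ext x; simp
  map_mul' u v := by
    ext x
    simp [add_left_comm, add_comm]

theorem translationHom_apply (u : Multiplicative (ZMod 2 × ZMod 4)) (x : torusT) :
    translationHom u x = x + torsionHom u.toAdd := rfl

theorem translationHom_torsionRot_pow (k : ℕ) (u : Multiplicative (ZMod 2 × ZMod 4)) :
    translationHom ((torsionRot ^ k) u) = rotI ^ k * translationHom u * (rotI ^ k)⁻¹ := by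
  induction k with
  | zero => simp
  | succ k ih =>
    have h (v) : translationHom (torsionRot v) = rotI * translationHom v * rotI⁻¹ := by
      rw [eq_mul_inv_iff_mul_eq]
      ext x
      simp only [Equiv.Perm.mul_apply, translationHom_apply, rotI_add, torsionHom_torsionRot]
    rw [pow_succ', MulAut.mul_apply, h, ih, pow_succ']
    group

/-- The abstract elliptic exceptional group `E(2,2,4) = (ℤ/2 × ℤ/4) ⋊ ℤ/4`. -/
abbrev ExceptionalGroup : Type :=
  Multiplicative (ZMod 2 × ZMod 4) ⋊[zmodPowHom torsionRot torsionRot_pow_four]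
    Multiplicative (ZMod 4)

/-- The action of `E(2,2,4)` on the torus. -/
noncomputable def exceptionalHom : ExceptionalGroup →* Equiv.Perm torusT :=
  SemidirectProduct.lift translationHom (zmodPowHom rotI rotI_pow_four) fun _ ↦
    MonoidHom.ext fun u ↦ translationHom_torsionRot_pow _ u

theorem exceptionalHom_mkT (s : ExceptionalGroup) (z : ℂ) :
    exceptionalHom s (mkT z) =
      mkT (I ^ s.right.toAdd.val * z) + torsionHom s.left.toAdd := by
  rw [← rotI_pow_mkT]
  rfl

theorem right_eq_one_of_exceptionalHom_translation {s : ExceptionalGroup} {c : ℂ}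
    (h : ∀ z : ℂ, exceptionalHom s (mkT z) = mkT (z + c)) : s.right = 1 := by
  have h0 := h 0
  have h1 := h (1 / 3)
  rw [exceptionalHom_mkT] at h0 h1
  rw [mul_zero, mkT_add 0 c, show mkT 0 = 0 from rfl, zero_add, zero_add] at h0
  rw [mkT_add, h0, add_left_inj, mkT_eq_mkT_iff] at h1
  obtain ⟨m, n, hmn⟩ := h1
  obtain ⟨u, k⟩ := s
  change k = 1
  replace hmn : I ^ k.toAdd.val * (1 / 3) - 1 / 3 = (m : ℂ) + n * I := hmn
  have hk : I ^ (Multiplicative.toAdd k).val = ((1 + 3 * m : ℤ) : ℂ) + ((3 * n : ℤ) : ℂ) * I := by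
    push_cast
    linear_combination 3 * hmn
  clear hmn h0 h
  obtain ⟨j, rfl⟩ := Multiplicative.ofAdd.surjective k
  rw [toAdd_ofAdd] at hk
  fin_cases j
  · rfl
  · have hI : I ^ 1 = ((0 : ℤ) : ℂ) + ((1 : ℤ) : ℂ) * I := by simp
    have hre := (intCast_add_intCast_mul_I_inj (hI.symm.trans hk)).1
    omega
  · have hI : I ^ 2 = ((-1 : ℤ) : ℂ) + ((0 : ℤ) : ℂ) * I := by simp
    have hre := (intCast_add_intCast_mul_I_inj (hI.symm.trans hk)).1
    omega
  · have hI : I ^ 3 = ((0 : ℤ) : ℂ) + ((-1 : ℤ) : ℂ) * I := by simp [I_pow_three]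
    have hre := (intCast_add_intCast_mul_I_inj (hI.symm.trans hk)).1
    omega

theorem exceptionalHom_injective : Function.Injective exceptionalHom := by
  rw [injective_iff_map_eq_one]
  intro s hs
  have hr : s.right = 1 := right_eq_one_of_exceptionalHom_translation (c := 0) fun z ↦ by
    rw [hs, add_zero, Equiv.Perm.one_apply]
  have h0 := exceptionalHom_mkT s 0
  rw [hs, mul_zero, Equiv.Perm.one_apply, left_eq_add] at h0
  have hl : s.left = 1 := torsionHom_injective (h0.trans (map_zero _).symm)
  exact SemidirectProduct.ext hl hr

theorem closure_ofAdd_one_zero_zero_one :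
    Subgroup.closure {Multiplicative.ofAdd ((1, 0) : ZMod 2 × ZMod 4), .ofAdd (0, 1)} = ⊤ := by
  rw [eq_top_iff]
  rintro u -
  have hu : u = .ofAdd ((1, 0) : ZMod 2 × ZMod 4) ^ u.toAdd.1.val *
      .ofAdd ((0, 1) : ZMod 2 × ZMod 4) ^ u.toAdd.2.val := by
    revert u; decide
  rw [hu]
  exact mul_mem (pow_mem (Subgroup.subset_closure (by simp)) _)
    (pow_mem (Subgroup.subset_closure (by simp)) _)

/-- The canonical generator `σ₀` of the cyclic factor of `E(2,2,4)`. -/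
def rotGen : ExceptionalGroup := SemidirectProduct.inr (.ofAdd 1)

theorem inr_eq_rotGen_pow (k : Multiplicative (ZMod 4)) :
    (SemidirectProduct.inr k : ExceptionalGroup) = rotGen ^ k.toAdd.val := by
  rw [rotGen, ← map_pow]
  congr 1
  revert k
  decide

/-- The element of `E(2,2,4)` acting as `z ↦ i z + u`. -/
def affGen (u : ZMod 2 × ZMod 4) : ExceptionalGroup :=
  SemidirectProduct.inl (.ofAdd u) * rotGen

theorem closure_rotGen_affGen :
    Subgroup.closure {rotGen, affGen (0, 1), affGen (1, 0)} = ⊤ := by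
  rw [eq_top_iff]
  set K := Subgroup.closure {rotGen, affGen (0, 1), affGen (1, 0)}
  have h0 : rotGen ∈ K := Subgroup.subset_closure (by simp)
  have h2 : affGen (0, 1) ∈ K := Subgroup.subset_closure (by simp)
  have h6 : affGen (1, 0) ∈ K := Subgroup.subset_closure (by simp)
  have hl : (⊤ : Subgroup _) ≤ K.comap SemidirectProduct.inl := by
    rw [← closure_ofAdd_one_zero_zero_one, Subgroup.closure_le]
    rintro _ (rfl | rfl)
    · exact (mul_mem_cancel_right h0).1 h6
    · exact (mul_mem_cancel_right h0).1 h2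
  intro s _
  rw [← SemidirectProduct.inl_left_mul_inr_right s, inr_eq_rotGen_pow]
  exact mul_mem (hl (Subgroup.mem_top s.left)) (pow_mem h0 _)

theorem exceptionalHom_rotGen_mkT (z : ℂ) : exceptionalHom rotGen (mkT z) = mkT (I * z) := by
  rw [exceptionalHom_mkT]
  change mkT (I ^ 1 * z) + torsionHom 0 = _
  rw [pow_one, map_zero, add_zero]

theorem exceptionalHom_inl_mkT (u : ZMod 2 × ZMod 4) (z : ℂ) :
    exceptionalHom (SemidirectProduct.inl (.ofAdd u)) (mkT z) = mkT z + torsionHom u := by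
  rw [exceptionalHom_mkT]
  change mkT (I ^ 0 * z) + torsionHom u = _
  rw [pow_zero, one_mul]

theorem exceptionalHom_affGen_mkT (u : ZMod 2 × ZMod 4) (z : ℂ) :
    exceptionalHom (affGen u) (mkT z) = mkT (I * z) + torsionHom u := by
  rw [affGen, map_mul, Equiv.Perm.mul_apply, exceptionalHom_rotGen_mkT, exceptionalHom_inl_mkT]

theorem card_exceptionalGroup : Nat.card ExceptionalGroup = 32 := by
  rw [SemidirectProduct.card]
  simp [Nat.card_eq_fintype_card]

/-- `σ₀(z) = iz`, `σ₂(z) = iz + (3+i)/4`, `σ₆(z) = iz + 1/2` induce well-defined bijections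
`σ̄₀, σ̄₂, σ̄₆` of `T = ℂ/L`.  Let `𝒢 = ⟨σ̄₀, σ̄₂, σ̄₆⟩ ≤ Perm T`.  Then (1) `𝒢` has order 32;
(2) the elements of `𝒢` induced by translations `z ↦ z + c` form a normal subgroup `N` of
`𝒢` of order 8 isomorphic to `ℤ/2 × ℤ/4`, generated by the translations by `1/2` and by
`(3+i)/4`; (3) the quotient `𝒢/N` is cyclic of order 4, generated by the image of `σ̄₀`. -/
theorem stmt_12 :
    ∃ s0 s2 s6 : Equiv.Perm torusT,
      (∀ z : ℂ, s0 (mkT z) = mkT (I * z)) ∧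
      (∀ z : ℂ, s2 (mkT z) = mkT (I * z + (3 + I) / 4)) ∧
      (∀ z : ℂ, s6 (mkT z) = mkT (I * z + 1 / 2)) ∧
      ∀ G : Subgroup (Equiv.Perm torusT), G = Subgroup.closure {s0, s2, s6} →
        Nat.card G = 32 ∧
        ∃ N : Subgroup G,
          (∀ g : G, g ∈ N ↔ ∃ c : ℂ, ∀ z : ℂ, (g : Equiv.Perm torusT) (mkT z) = mkT (z + c)) ∧
          ∃ _ : N.Normal,
            Nat.card N = 8 ∧
            Nonempty (N ≃* Multiplicative (ZMod 2 × ZMod 4)) ∧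
            (∃ t1 t2 : G,
              (∀ z : ℂ, (t1 : Equiv.Perm torusT) (mkT z) = mkT (z + 1 / 2)) ∧
              (∀ z : ℂ, (t2 : Equiv.Perm torusT) (mkT z) = mkT (z + (3 + I) / 4)) ∧
              N = Subgroup.closure {t1, t2}) ∧
            Nat.card (G ⧸ N) = 4 ∧
            ∃ g0 : G, (g0 : Equiv.Perm torusT) = s0 ∧
              ∀ q : G ⧸ N, ∃ k : ℤ, q = (QuotientGroup.mk g0 : G ⧸ N) ^ k := by
  refine ⟨exceptionalHom rotGen, exceptionalHom (affGen (0, 1)), exceptionalHom (affGen (1, 0)),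
    exceptionalHom_rotGen_mkT, fun z ↦ ?_, fun z ↦ ?_, ?_⟩
  · rw [exceptionalHom_affGen_mkT, torsionHom_zero_one, mkT_add]
  · rw [exceptionalHom_affGen_mkT, torsionHom_one_zero, mkT_add]
  intro G hG
  have hrange : exceptionalHom.range = G := by
    rw [hG, MonoidHom.range_eq_map, ← closure_rotGen_affGen, MonoidHom.map_closure]
    simp [Set.image_insert_eq]
  let e : ExceptionalGroup ≃* G :=
    (MonoidHom.ofInjective exceptionalHom_injective).trans (MulEquiv.subgroupCongr hrange)
  have he (s : ExceptionalGroup) : (e s : Equiv.Perm torusT) = exceptionalHom s := rfl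
  let ι : Multiplicative (ZMod 2 × ZMod 4) →* G := e.toMonoidHom.comp SemidirectProduct.inl
  have hι : Function.Injective ι := e.injective.comp SemidirectProduct.inl_injective
  let π : G →* Multiplicative (ZMod 4) := SemidirectProduct.rightHom.comp e.symm.toMonoidHom
  have hπ : Function.Surjective π :=
    SemidirectProduct.rightHom_surjective.comp e.symm.surjective
  have hπe (s : ExceptionalGroup) : π (e s) = s.right := by
    change (e.symm (e s)).right = s.right
    rw [e.symm_apply_apply]
  have hker : ι.range = π.ker := by
    ext g
    obtain ⟨s, rfl⟩ := e.surjective g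
    rw [MonoidHom.mem_ker, hπe, MonoidHom.mem_range]
    constructor
    · rintro ⟨u, hu⟩
      rw [← e.injective hu, SemidirectProduct.right_inl]
    · intro hs
      exact ⟨s.left, congrArg e (SemidirectProduct.ext rfl hs.symm)⟩
  let eN : π.ker ≃* Multiplicative (ZMod 2 × ZMod 4) :=
    (MulEquiv.subgroupCongr hker.symm).trans (MonoidHom.ofInjective hι).symm
  let eQ : G ⧸ π.ker ≃* Multiplicative (ZMod 4) :=
    QuotientGroup.quotientKerEquivOfSurjective π hπ
  refine ⟨?_, π.ker, fun g ↦ ?_, inferInstance, ?_, ⟨eN⟩,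
    ⟨ι (.ofAdd (1, 0)), ι (.ofAdd (0, 1)), fun z ↦ ?_, fun z ↦ ?_, ?_⟩, ?_,
    e rotGen, rfl, fun q ↦ ?_⟩
  · rw [← Nat.card_congr e.toEquiv, card_exceptionalGroup]
  · obtain ⟨s, rfl⟩ := e.surjective g
    rw [MonoidHom.mem_ker, hπe, he]
    constructor
    · intro hs
      obtain ⟨c, hc⟩ := mkT_surjective (torsionHom s.left.toAdd)
      refine ⟨c, fun z ↦ ?_⟩
      rw [exceptionalHom_mkT, hs, mkT_add, hc, toAdd_one, ZMod.val_zero, pow_zero, one_mul]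
    · rintro ⟨c, hc⟩
      exact right_eq_one_of_exceptionalHom_translation hc
  · rw [Nat.card_congr eN.toEquiv]
    simp [Nat.card_eq_fintype_card]
  · exact (exceptionalHom_inl_mkT _ z).trans (by rw [torsionHom_one_zero, mkT_add])
  · exact (exceptionalHom_inl_mkT _ z).trans (by rw [torsionHom_zero_one, mkT_add])
  · rw [← hker, MonoidHom.range_eq_map, ← closure_ofAdd_one_zero_zero_one,
      MonoidHom.map_closure, Set.image_pair]
  · rw [Nat.card_congr eQ.toEquiv]
    simp [Nat.card_eq_fintype_card]
  · obtain ⟨g, rfl⟩ := QuotientGroup.mk_surjective q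
    obtain ⟨s, rfl⟩ := e.surjective g
    refine ⟨s.right.toAdd.val, eQ.injective ?_⟩
    rw [zpow_natCast, map_pow]
    change π (e s) = π (e rotGen) ^ _
    rw [hπe, hπe]
    generalize s.right = k
    revert k
    decide
end

section
/- Let x, y ∈ ℂ satisfy y² = 4x³ − x and 2x ≠ 1. Set u = (2x+1)/(2(2x−1)) and v = 2y/(2x−1)². Then v² = 4u³ − u, and in ℂ⁴ one has the identity (4x² − 4x + 1, x² + x + 1/4, 2x² − 1/2, 2y) = (2x−1)² · (1, u², u, v). -/
/-- For `y² = 4x³ - x` and `2x ≠ 1`, putting `u = (2x+1)/(2(2x-1))` and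
`v = 2y/(2x-1)²`, one has `v² = 4u³ - u` and
`(4x² - 4x + 1, x² + x + 1/4, 2x² - 1/2, 2y) = (2x-1)² · (1, u², u, v)` in `ℂ⁴`:
the projective transformation `M(ρ₁)` maps the embedded curve to itself. -/
theorem stmt_16 :
    ∀ x y : ℂ, y ^ 2 = 4 * x ^ 3 - x → 2 * x ≠ 1 →
      let u : ℂ := (2 * x + 1) / (2 * (2 * x - 1))
      let v : ℂ := 2 * y / (2 * x - 1) ^ 2
      v ^ 2 = 4 * u ^ 3 - u ∧
      (![4 * x ^ 2 - 4 * x + 1, x ^ 2 + x + 1/4, 2 * x ^ 2 - 1/2, 2 * y] : Fin 4 → ℂ) =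
        (2 * x - 1) ^ 2 • ![1, u ^ 2, u, v] := by
  intro x y hy hx u v
  obtain ⟨d, rfl⟩ : ∃ d : ℂ, x = (d + 1) / 2 := ⟨2 * x - 1, by ring⟩
  have hd : d ≠ 0 := by
    rintro rfl
    exact hx (by norm_num)
  have hu : u = (d + 2) / (2 * d) := by
    simp only [u]
    congr 1 <;> ring
  have hv : v = 2 * y / d ^ 2 := by
    simp only [v]
    congr 2
    ring
  have hx_sub : 2 * ((d + 1) / 2) - 1 = d := by ring
  rw [hu, hv, hx_sub]
  constructor
  · rw [div_pow, mul_pow, hy]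
    field_simp
    ring
  · ext i
    fin_cases i <;> simp <;> field_simp <;> ring
end

section
/- Let x, y ∈ ℂ satisfy y² = 4x³ − x and 2x ≠ −1, and let i = √−1. Set u = (2x−1)/(2(2x+1)) and v = −2iy/(2x+1)². Then v² = 4u³ − u, and in ℂ⁴ one has the identity (4x² + 4x + 1, x² − x + 1/4, 2x² − 1/2, −2iy) = (2x+1)² · (1, u², u, v). -/
open Complex

/-- For `y² = 4x³ - x` and `2x ≠ -1`, putting `u = (2x-1)/(2(2x+1))` and
`v = -2iy/(2x+1)²`, one has `v² = 4u³ - u` and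
`(4x² + 4x + 1, x² - x + 1/4, 2x² - 1/2, -2iy) = (2x+1)² · (1, u², u, v)` in `ℂ⁴`:
the projective transformation `M(σ₆)` maps the embedded curve to itself. -/
theorem stmt_17 :
    ∀ x y : ℂ, y ^ 2 = 4 * x ^ 3 - x → 2 * x ≠ -1 →
      let u : ℂ := (2 * x - 1) / (2 * (2 * x + 1))
      let v : ℂ := -2 * I * y / (2 * x + 1) ^ 2
      v ^ 2 = 4 * u ^ 3 - u ∧
      (![4 * x ^ 2 + 4 * x + 1, x ^ 2 - x + 1/4, 2 * x ^ 2 - 1/2, -2 * I * y] :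
          Fin 4 → ℂ) =
        (2 * x + 1) ^ 2 • ![1, u ^ 2, u, v] := by
  intro x y hxy hx u v
  have hd : 2 * x + 1 ≠ 0 := fun h => hx (eq_neg_of_add_eq_zero_left h)
  have hu : (2 * x + 1) * u = x - 1 / 2 := by
    simp only [u]
    field_simp
  have hv : (2 * x + 1) ^ 2 * v = -2 * I * y := mul_div_cancel₀ _ (pow_ne_zero 2 hd)
  clear_value u v
  refine ⟨mul_left_cancel₀ (pow_ne_zero 4 hd) ?_, ?_⟩
  · calc (2 * x + 1) ^ 4 * v ^ 2 = ((2 * x + 1) ^ 2 * v) ^ 2 := by ring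
      _ = -4 * (4 * x ^ 3 - x) := by
        rw [hv, ← hxy]
        linear_combination 4 * y ^ 2 * I_sq
      _ = 4 * (2 * x + 1) * ((2 * x + 1) * u) ^ 3
          - (2 * x + 1) ^ 3 * ((2 * x + 1) * u) := by
        rw [hu]
        ring
      _ = (2 * x + 1) ^ 4 * (4 * u ^ 3 - u) := by ring
  · simp only [Matrix.smul_cons, Matrix.smul_empty, smul_eq_mul, hv, ← mul_pow, hu]
    have h : (2 * x + 1) ^ 2 * u = 2 * x ^ 2 - 1 / 2 := by
      linear_combination (2 * x + 1) * hu
    rw [h]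
    congr 2 <;> ring
end
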